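/- Let c ≥ 2, C = {1, 2c}, and p ≥ 2. (i) If (h₁, …, h_p) is a partition of n+1 into p positive parts that is not an entering partition, then there exists a partition (h'₁, …, h'_p) of n into p positive parts with G_C(h₁) XOR ⋯ XOR G_C(h_p) = (G_C(h'₁) XOR ⋯ XOR G_C(h'_p)) XOR 1. (ii) If (j₁, …, j_p) is a partition of n into p positive parts that is not an exiting partition, then there exists a partition (j'₁, …, j'_p) of n+1 into p positive parts with G_C(j'₁) XOR ⋯ XOR G_C(j'_p) = (G_C(j₁) XOR ⋯ XOR G_C(j_p)) XOR 1. -/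

import Mathlib

/-- The minimum excludant of a set of naturals. -/
noncomputable def mex (S : Set ℕ) : ℕ := sInf {v | v ∉ S}

/-- Fueled auxiliary for the Grundy sequence of CUT with cut-set `C`. -/
noncomputable def cutGAux (C : Finset ℕ) : ℕ → ℕ → ℕ
  | 0, _ => 0
  | fuel + 1, n =>
      mex {v | ∃ d ∈ C, ∃ l : List ℕ, l.length = d + 1 ∧ (∀ x ∈ l, 0 < x) ∧
            l.sum = n ∧ (l.map (cutGAux C fuel)).foldr (· ^^^ ·) 0 = v}

/-- The Grundy (nim-value) sequence of the game CUT with cut-set `C`. -/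
noncomputable def cutG (C : Finset ℕ) (n : ℕ) : ℕ := cutGAux C n n

/-- The nim-value of an option (a tuple of pile sizes). -/
noncomputable def nimVal (C : Finset ℕ) (l : List ℕ) : ℕ :=
  (l.map (cutG C)).foldr (· ^^^ ·) 0

/-- `m` is an innumber with respect to `c`. -/
def Innumber (c m : ℕ) : Prop := 0 < m ∧ (m % (2*c) = 1 ∨ m % (12*c) = 4*c + 2)

/-- `m` is an outnumber with respect to `c`. -/
def Outnumber (c m : ℕ) : Prop := 0 < m ∧ (m % (2*c) = 0 ∨ m % (12*c) = 4*c + 1)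

/-- A partition is entering if all its parts are innumbers. -/
def Entering (c : ℕ) (l : List ℕ) : Prop := ∀ m ∈ l, Innumber c m

/-- A partition is exiting if all its parts are outnumbers. -/
def Exiting (c : ℕ) (l : List ℕ) : Prop := ∀ m ∈ l, Outnumber c m

/-- The nim-sum of a list of naturals. -/
def nimSum (l : List ℕ) : ℕ := l.foldr (· ^^^ ·) 0

lemma nimSum_nil : nimSum [] = 0 := rfl

lemma nimSum_cons (a : ℕ) (l : List ℕ) : nimSum (a :: l) = a ^^^ nimSum l := rfl

lemma nimSum_append (l l' : List ℕ) : nimSum (l ++ l') = nimSum l ^^^ nimSum l' := by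
  induction l with
  | nil => simp [nimSum_nil]
  | cons a l ih => simp [nimSum_cons, ih, Nat.xor_assoc]

lemma nimSum_map_xor_mid (f : ℕ → ℕ) (l l' : List ℕ) (a b : ℕ) (h : f a = f b ^^^ 1) :
    nimSum ((l ++ a :: l').map f) = nimSum ((l ++ b :: l').map f) ^^^ 1 := by
  simp only [List.map_append, List.map_cons, nimSum_append, nimSum_cons, h]
  ac_rfl

lemma xor_le_add (a b : ℕ) : a ^^^ b ≤ a + b := by
  induction a using Nat.strong_induction_on generalizing b with
  | _ a ih =>
    rcases Nat.eq_zero_or_pos a with rfl | ha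
    · simp
    · have h := ih (a / 2) (by omega) (b / 2)
      have h1 : (a ^^^ b) / 2 = a / 2 ^^^ b / 2 := Nat.xor_div_two
      have h2 : (a ^^^ b) % 2 = (a + b) % 2 := Nat.xor_mod_two_eq
      omega

lemma nimSum_le_sum (l : List ℕ) : nimSum l ≤ l.sum := by
  induction l with
  | nil => simp [nimSum_nil]
  | cons a l ih =>
    rw [nimSum_cons, List.sum_cons]
    exact (xor_le_add _ _).trans (by omega)

lemma nimSum_div_two_pow (k : ℕ) (l : List ℕ) :
    nimSum l / 2 ^ k = nimSum (l.map (· / 2 ^ k)) := by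
  induction l with
  | nil => simp [nimSum_nil]
  | cons a l ih => rw [nimSum_cons, Nat.xor_div_two_pow, ih, List.map_cons, nimSum_cons]

lemma nimSum_mod_two (l : List ℕ) : nimSum l % 2 = l.sum % 2 := by
  induction l with
  | nil => simp [nimSum_nil]
  | cons a l ih =>
    rw [nimSum_cons, Nat.xor_mod_two_eq, List.sum_cons]
    omega

lemma sum_map_mod_two_congr {α : Type*} (l : List α) (f g : α → ℕ)
    (h : ∀ x ∈ l, f x % 2 = g x % 2) : (l.map f).sum % 2 = (l.map g).sum % 2 := by
  induction l with
  | nil => rfl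
  | cons a l ih =>
    have h1 := h a (by simp)
    have h2 := ih fun x hx => h x (by simp [hx])
    simp only [List.map_cons, List.sum_cons]
    omega

lemma nimSum_replicate_zero (k : ℕ) : nimSum (List.replicate k 0) = 0 := by
  induction k with
  | zero => rfl
  | succ k ih => rw [List.replicate_succ, nimSum_cons, ih]; rfl

lemma eight_mul_add_xor (q u v : ℕ) (hu : u < 8) (hv : v < 8) :
    (8 * q + u) ^^^ v = 8 * q + (u ^^^ v) := by
  have h1 : ((8 * q + u) ^^^ v) / 2 ^ 3 = (8 * q + u) / 2 ^ 3 ^^^ v / 2 ^ 3 :=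
    Nat.xor_div_two_pow
  have h2 : ((8 * q + u) ^^^ v) % 2 ^ 3 = (8 * q + u) % 2 ^ 3 ^^^ v % 2 ^ 3 :=
    Nat.xor_mod_two_pow
  have e1 : (8 * q + u) / 2 ^ 3 = q := by omega
  have e2 : v / 2 ^ 3 = 0 := by omega
  have e3 : (8 * q + u) % 2 ^ 3 = u := by omega
  have e4 : v % 2 ^ 3 = v := by omega
  rw [e1, e2, Nat.xor_zero] at h1
  rw [e3, e4] at h2
  omega

/-- Indicator of the two blocks on which the parity of the Grundy value is reversed. -/
def flipBit (K : ℕ) : ℕ := if K = 2 ∨ K = 3 then 1 else 0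

/-- The bit of weight four of the Grundy value at offset `s` of block `K`. -/
def highBit (K s : ℕ) : ℕ := if 4 ≤ K ∨ (K = 2 ∧ 1 ≤ s) then 1 else 0

/-- The Grundy value at offset `s` of block `K` of the first period. -/
def blockVal (K s : ℕ) : ℕ := (s + flipBit K) % 2 + 2 * (K % 2) + 4 * highBit K s

/-- The index of the period of length `12 * c` containing `n`. -/
def rowIdx (c n : ℕ) : ℕ := (n - 1) / (2 * c) / 6

/-- The index, inside its period, of the block of length `2 * c` containing `n`. -/
def blockIdx (c n : ℕ) : ℕ := (n - 1) / (2 * c) % 6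

/-- The offset of `n` in its block. -/
def offset (c n : ℕ) : ℕ := (n - 1) % (2 * c)

/-- The closed form of the Grundy sequence for the cut-set `{1, 2 * c}`. -/
def closedForm (c n : ℕ) : ℕ := 8 * rowIdx c n + blockVal (blockIdx c n) (offset c n)

lemma highBit_le_one (K s : ℕ) : highBit K s ≤ 1 := by unfold highBit; split <;> omega

lemma blockVal_lt (K s : ℕ) : blockVal K s < 8 := by
  have := highBit_le_one K s
  unfold blockVal
  omega

/-- The number at offset `s` of block `K` of row `q`. -/
def place (c q K s : ℕ) : ℕ := 2 * c * (6 * q + K) + s + 1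

lemma place_decomp {c n : ℕ} (hn : 0 < n) :
    n = place c (rowIdx c n) (blockIdx c n) (offset c n) := by
  unfold place rowIdx blockIdx offset
  rw [Nat.div_add_mod, Nat.div_add_mod]
  omega

lemma blockIdx_lt (c n : ℕ) : blockIdx c n < 6 := Nat.mod_lt _ (by norm_num)

lemma offset_lt {c : ℕ} (hc : 2 ≤ c) (n : ℕ) : offset c n < 2 * c := Nat.mod_lt _ (by omega)

lemma closedForm_place {c q K s : ℕ} (hK : K < 6) (hs : s < 2 * c) :
    closedForm c (place c q K s) = 8 * q + blockVal K s := by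
  have h1 : (place c q K s - 1) / (2 * c) = 6 * q + K := by
    rw [place, Nat.add_sub_cancel, Nat.mul_add_div (by omega), Nat.div_eq_of_lt hs, add_zero]
  have h2 : (place c q K s - 1) % (2 * c) = s := by
    rw [place, Nat.add_sub_cancel, Nat.mul_add_mod, Nat.mod_eq_of_lt hs]
  have h3 : (6 * q + K) / 6 = q := by omega
  have h4 : (6 * q + K) % 6 = K := by omega
  rw [closedForm, rowIdx, blockIdx, offset, h1, h2, h3, h4]

/-- The set of values of the options of `n`, for a given assignment of pile values. -/
def optionValues (c : ℕ) (G : ℕ → ℕ) (n : ℕ) : Set ℕ :=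
  {v | ∃ d ∈ ({1, 2 * c} : Finset ℕ), ∃ l : List ℕ, l.length = d + 1 ∧ (∀ x ∈ l, 0 < x) ∧
    l.sum = n ∧ nimSum (l.map G) = v}

lemma pair_mem_optionValues {c q K s K' s' n : ℕ} (hK : K < 6) (hs : s < 2 * c) (hK' : K' < 6)
    (hs' : s' < 2 * c) (h : place c q K s + place c 0 K' s' = n) :
    8 * q + (blockVal K s ^^^ blockVal K' s') ∈ optionValues c (closedForm c) n := by
  refine ⟨1, by simp, [place c q K s, place c 0 K' s'], rfl, ?_, by simpa using h, ?_⟩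
  · simp [place]
  · simp only [List.map_cons, List.map_nil, nimSum_cons, nimSum_nil, Nat.xor_zero,
      closedForm_place hK hs, closedForm_place hK' hs', mul_zero, zero_add]
    exact eight_mul_add_xor _ _ _ (blockVal_lt _ _) (blockVal_lt _ _)

lemma triple_mem_optionValues {c q K s K' s' s'' n : ℕ} (hc : 2 ≤ c) (hK : K < 6)
    (hs : s < 2 * c) (hK' : K' < 6) (hs' : s' < 2 * c) (hs'' : s'' < 2 * c)
    (hle : place c q K s + place c 0 K' s' + place c 0 0 s'' + 2 * c ≤ n + 2)
    (hpar : (place c q K s + place c 0 K' s' + place c 0 0 s'') % 2 = n % 2) :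
    8 * q + (blockVal K s ^^^ (blockVal K' s' ^^^ blockVal 0 s'')) ∈
      optionValues c (closedForm c) n := by
  obtain ⟨w, hw⟩ : ∃ w, place c q K s + place c 0 K' s' + place c 0 0 s'' + 2 * c + 2 * w
      = n + 2 :=
    ⟨(n + 2 - (place c q K s + place c 0 K' s' + place c 0 0 s'' + 2 * c)) / 2, by omega⟩
  have h1 : closedForm c 1 = 0 := by
    have h := closedForm_place (c := c) (q := 0) (K := 0) (s := 0) (by norm_num) (by omega)
    simpa [place, blockVal, flipBit, highBit] using h
  refine ⟨2 * c, by simp, place c q K s :: place c 0 K' s' :: place c 0 0 s'' :: (w + 1) ::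
    (w + 1) :: List.replicate (2 * c - 4) 1, ?_, ?_, ?_, ?_⟩
  · simp only [List.length_cons, List.length_replicate]
    omega
  · intro x hx
    simp only [List.mem_cons, List.mem_replicate] at hx
    unfold place at hx
    omega
  · simp only [List.sum_cons, List.sum_replicate, smul_eq_mul, mul_one]
    omega
  · simp only [List.map_cons, List.map_replicate, nimSum_cons, h1, nimSum_replicate_zero,
      Nat.xor_zero, Nat.xor_self, closedForm_place hK hs, closedForm_place hK' hs',
      closedForm_place (q := 0) (show 0 < 6 by norm_num) hs'', mul_zero, zero_add]
    rw [eight_mul_add_xor _ _ _ (blockVal_lt _ _)]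
    exact Nat.xor_lt_two_pow (n := 3) (blockVal_lt _ _) (blockVal_lt _ _)

/-- Values obtained from a triple completed by pairs of equal parts, for odd `n`. -/
lemma mem_optionValues_of_odd {c q n u : ℕ} (hc : 2 ≤ c) (hu : u < 8) (hn : n % 2 = 1)
    (hle : 2 * c * (6 * q) + ![3, 4 * c + 3, 2 * c + 3, 6 * c + 3, 8 * c + 3, 4 * c + 5,
      10 * c + 3, 6 * c + 5] ⟨u, hu⟩ + 2 * c ≤ n + 2) :
    8 * q + u ∈ optionValues c (closedForm c) n := by
  have key := fun K s K' s' s'' => triple_mem_optionValues (c := c) (q := q) (K := K) (s := s)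
    (K' := K') (s' := s') (s'' := s'') (n := n) hc
  simp only [place, mul_add, mul_zero, zero_add] at key hle
  have e : 2 * c * (6 * q) = 2 * (c * (6 * q)) := by ring
  rw [e] at hle
  simp only [e] at key
  generalize c * (6 * q) = P at *
  interval_cases u <;> simp at hle
  · exact key 0 0 0 0 0 (by omega) (by omega) (by omega) (by omega) (by omega) (by omega) (by omega)
  · exact key 2 0 0 0 0 (by omega) (by omega) (by omega) (by omega) (by omega) (by omega) (by omega)
  · exact key 1 0 0 0 0 (by omega) (by omega) (by omega) (by omega) (by omega) (by omega) (by omega)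
  · exact key 2 0 1 0 0 (by omega) (by omega) (by omega) (by omega) (by omega) (by omega) (by omega)
  · exact key 4 0 0 0 0 (by omega) (by omega) (by omega) (by omega) (by omega) (by omega) (by omega)
  · exact key 2 2 0 0 0 (by omega) (by omega) (by omega) (by omega) (by omega) (by omega) (by omega)
  · exact key 4 0 1 0 0 (by omega) (by omega) (by omega) (by omega) (by omega) (by omega) (by omega)
  · exact key 2 1 1 1 0 (by omega) (by omega) (by omega) (by omega) (by omega) (by omega) (by omega)

/-- Values obtained from a triple completed by pairs of equal parts, for even `n`. -/
lemma mem_optionValues_of_even {c q n u : ℕ} (hc : 2 ≤ c) (hu : u < 8) (hn : n % 2 = 0)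
    (hle : 2 * c * (6 * q) + ![4 * c + 4, 4, 6 * c + 4, 2 * c + 4, 4 * c + 4, 8 * c + 4,
      6 * c + 4, 10 * c + 4] ⟨u, hu⟩ + 2 * c ≤ n + 2) :
    8 * q + u ∈ optionValues c (closedForm c) n := by
  have key := fun K s K' s' s'' => triple_mem_optionValues (c := c) (q := q) (K := K) (s := s)
    (K' := K') (s' := s') (s'' := s'') (n := n) hc
  simp only [place, mul_add, mul_zero, zero_add] at key hle
  have e : 2 * c * (6 * q) = 2 * (c * (6 * q)) := by ring
  rw [e] at hle
  simp only [e] at key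
  generalize c * (6 * q) = P at *
  interval_cases u <;> simp at hle
  · exact key 2 0 0 1 0 (by omega) (by omega) (by omega) (by omega) (by omega) (by omega) (by omega)
  · exact key 0 1 0 0 0 (by omega) (by omega) (by omega) (by omega) (by omega) (by omega) (by omega)
  · exact key 2 0 1 1 0 (by omega) (by omega) (by omega) (by omega) (by omega) (by omega) (by omega)
  · exact key 1 1 0 0 0 (by omega) (by omega) (by omega) (by omega) (by omega) (by omega) (by omega)
  · exact key 2 1 0 0 0 (by omega) (by omega) (by omega) (by omega) (by omega) (by omega) (by omega)
  · exact key 4 1 0 0 0 (by omega) (by omega) (by omega) (by omega) (by omega) (by omega) (by omega)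
  · exact key 2 1 1 0 0 (by omega) (by omega) (by omega) (by omega) (by omega) (by omega) (by omega)
  · exact key 4 1 1 0 0 (by omega) (by omega) (by omega) (by omega) (by omega) (by omega) (by omega)

lemma mem_optionValues_of_row_lt {c q q' K s u : ℕ} (hc : 2 ≤ c) (hu : u < 8) (hq : q' < q) :
    8 * q' + u ∈ optionValues c (closedForm c) (place c q K s) := by
  obtain ⟨d, rfl⟩ := Nat.exists_eq_add_of_lt hq
  have e : place c (q' + d + 1) K s
      = 2 * c * (6 * q') + 12 * c + 2 * (c * (6 * d + K)) + s + 1 := by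
    unfold place; ring
  have e' : 2 * c * (6 * q') = 2 * (c * (6 * q')) := by ring
  rcases Nat.mod_two_eq_zero_or_one (place c (q' + d + 1) K s) with h | h
  · apply mem_optionValues_of_even hc hu h
    rw [e] at h ⊢
    rw [e'] at h ⊢
    generalize c * (6 * q') = P at *
    generalize c * (6 * d + K) = Q at *
    interval_cases u <;> simp <;> omega
  · apply mem_optionValues_of_odd hc hu h
    rw [e] at h ⊢
    rw [e'] at h ⊢
    generalize c * (6 * q') = P at *
    generalize c * (6 * d + K) = Q at *
    interval_cases u <;> simp <;> omega

lemma blockVal_eq_of_mod {K s t : ℕ} (h : s % 2 = t % 2) (h' : K = 2 → (1 ≤ s ↔ 1 ≤ t)) :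
    blockVal K s = blockVal K t := by
  have h1 : highBit K s = highBit K t := by
    unfold highBit
    congr 1
    simp only [eq_iff_iff]
    tauto
  unfold blockVal
  omega

set_option maxHeartbeats 1000000 in
lemma mem_optionValues_of_lt_blockVal {c q K s u : ℕ} (hc : 2 ≤ c) (hK : K < 6)
    (hs : s < 2 * c) (hu : u < blockVal K s) :
    8 * q + u ∈ optionValues c (closedForm c) (place c q K s) := by
  have hu8 : u < 8 := hu.trans (blockVal_lt K s)
  have pair : ∀ K₁ s₁ K₂ s₂ : ℕ, K₁ < 6 → s₁ < 2 * c → K₂ < 6 → s₂ < 2 * c →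
      place c q K₁ s₁ + place c 0 K₂ s₂ = place c q K s →
      ∀ t₁ t₂ : ℕ, s₁ % 2 = t₁ % 2 → (K₁ = 2 → (1 ≤ s₁ ↔ 1 ≤ t₁)) → s₂ % 2 = t₂ % 2 →
      (K₂ = 2 → (1 ≤ s₂ ↔ 1 ≤ t₂)) → blockVal K₁ t₁ ^^^ blockVal K₂ t₂ = u →
      8 * q + u ∈ optionValues c (closedForm c) (place c q K s) := by
    intro K₁ s₁ K₂ s₂ h₁ h₂ h₃ h₄ h t₁ t₂ e₁ e₁' e₂ e₂' e
    rw [← e, ← blockVal_eq_of_mod e₁ e₁', ← blockVal_eq_of_mod e₂ e₂']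
    exact pair_mem_optionValues h₁ h₂ h₃ h₄ h
  have hodd := mem_optionValues_of_odd (q := q) (n := place c q K s) hc hu8
  have heven := mem_optionValues_of_even (q := q) (n := place c q K s) hc hu8
  generalize hT : (8 * q + u ∈ optionValues c (closedForm c) (place c q K s)) = T at *
  have e : 2 * c * (6 * q) = 2 * (c * (6 * q)) := by ring
  simp only [place, mul_add, mul_zero, zero_add] at pair hodd heven
  rw [e] at hodd heven
  simp only [e] at pair
  clear hT
  generalize c * (6 * q) = P at *
  unfold blockVal flipBit highBit at hu
  interval_cases K <;> interval_cases u <;> simp at hu hodd heven <;> (try split at hu) <;>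
  first
  | omega
  | rcases Nat.mod_two_eq_zero_or_one s with h | h <;>
    first
    | omega
    | exact hodd (by omega) (by omega)
    | exact heven (by omega) (by omega)
    | exact pair 0 (s - 1) 0 0 (by omega) (by omega) (by omega) (by omega) (by omega)
        0 0 (by omega) (by omega) (by omega) (by omega) rfl
    | exact pair 1 (s - 1) 0 0 (by omega) (by omega) (by omega) (by omega) (by omega)
        0 0 (by omega) (by omega) (by omega) (by omega) rfl
    | exact pair 2 (s - 1) 0 0 (by omega) (by omega) (by omega) (by omega) (by omega)
        1 0 (by omega) (by omega) (by omega) (by omega) rfl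
    | exact pair 0 s 0 (2 * c - 1) (by omega) (by omega) (by omega) (by omega) (by omega)
        0 1 (by omega) (by omega) (by omega) (by omega) rfl
    | exact pair 0 s 0 (2 * c - 1) (by omega) (by omega) (by omega) (by omega) (by omega)
        1 1 (by omega) (by omega) (by omega) (by omega) rfl
    | exact pair 1 s 0 (2 * c - 1) (by omega) (by omega) (by omega) (by omega) (by omega)
        0 1 (by omega) (by omega) (by omega) (by omega) rfl
    | exact pair 1 s 0 (2 * c - 1) (by omega) (by omega) (by omega) (by omega) (by omega)
        1 1 (by omega) (by omega) (by omega) (by omega) rfl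
    | exact pair 1 (s - 1) 1 0 (by omega) (by omega) (by omega) (by omega) (by omega)
        0 0 (by omega) (by omega) (by omega) (by omega) rfl
    | exact pair 1 (s - 1) 1 0 (by omega) (by omega) (by omega) (by omega) (by omega)
        1 0 (by omega) (by omega) (by omega) (by omega) rfl

lemma closedForm_div_eight (c n : ℕ) : closedForm c n / 2 ^ 3 = rowIdx c n := by
  have := blockVal_lt (blockIdx c n) (offset c n)
  unfold closedForm
  omega

lemma closedForm_mod_two (c n : ℕ) :
    closedForm c n % 2 = (offset c n + flipBit (blockIdx c n)) % 2 := by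
  unfold closedForm blockVal
  omega

lemma closedForm_div_two_mod_two (c n : ℕ) :
    closedForm c n / 2 ^ 1 % 2 = blockIdx c n % 2 := by
  unfold closedForm blockVal
  omega

lemma closedForm_div_four_mod_two (c n : ℕ) :
    closedForm c n / 2 ^ 2 % 2 = highBit (blockIdx c n) (offset c n) % 2 := by
  have := highBit_le_one (blockIdx c n) (offset c n)
  unfold closedForm blockVal
  omega

lemma nimSum_map_div_two_pow_mod_two {G f : ℕ → ℕ} {k : ℕ}
    (h : ∀ x, G x / 2 ^ k % 2 = f x % 2) (l : List ℕ) :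
    nimSum (l.map G) / 2 ^ k % 2 = (l.map f).sum % 2 := by
  rw [nimSum_div_two_pow, nimSum_mod_two, List.map_map]
  exact sum_map_mod_two_congr _ _ _ fun x _ => h x

lemma sum_eq_of_pos {c : ℕ} (l : List ℕ) (hl : ∀ x ∈ l, 0 < x) :
    l.sum = 2 * c * (6 * (l.map (rowIdx c)).sum + (l.map (blockIdx c)).sum)
      + (l.map (offset c)).sum + l.length := by
  induction l with
  | nil => simp
  | cons a l ih =>
    have h1 := place_decomp (c := c) (hl a (by simp))
    have h2 := ih fun x hx => hl x (by simp [hx])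
    simp only [List.map_cons, List.sum_cons, List.length_cons, h2]
    nth_rw 1 [h1]
    unfold place
    ring

/-- An option with the same value as `n` has no carry between rows, and the low bits of its
block data agree in parity with those of `n`. -/
lemma block_sums_of_nimSum_eq {c n : ℕ} (hc : 2 ≤ c) (hn : 0 < n) {l : List ℕ}
    (hl : ∀ x ∈ l, 0 < x) (hne : 0 < l.length) (hsum : l.sum = n)
    (h : nimSum (l.map (closedForm c)) = closedForm c n) :
    2 * c * (l.map (blockIdx c)).sum + (l.map (offset c)).sum + l.length
        = 2 * c * blockIdx c n + offset c n + 1 ∧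
      ((l.map (offset c)).sum + (l.map fun x => flipBit (blockIdx c x)).sum) % 2
        = (offset c n + flipBit (blockIdx c n)) % 2 ∧
      (l.map (blockIdx c)).sum % 2 = blockIdx c n % 2 ∧
      (l.map fun x => highBit (blockIdx c x) (offset c x)).sum % 2
        = highBit (blockIdx c n) (offset c n) % 2 := by
  refine ⟨?_, ?_, ?_, ?_⟩
  · have hrow : rowIdx c n ≤ (l.map (rowIdx c)).sum := by
      rw [← closedForm_div_eight, ← h, nimSum_div_two_pow, List.map_map]
      refine (nimSum_le_sum _).trans (le_of_eq ?_)
      congr 2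
      funext x
      exact closedForm_div_eight c x
    have hdec := place_decomp (c := c) hn
    have hs := sum_eq_of_pos (c := c) l hl
    rw [hsum] at hs
    have hK := blockIdx_lt c n
    have ho := offset_lt hc n
    have hlt : 2 * c * (6 * (l.map (rowIdx c)).sum) < 2 * c * (6 * rowIdx c n + 6) := by
      have : 2 * c * (blockIdx c n + 1) ≤ 2 * c * 6 := by gcongr; omega
      unfold place at hdec
      simp only [mul_add, mul_one] at *
      omega
    have hlt' := lt_of_mul_lt_mul_left hlt (Nat.zero_le _)
    have heq : (l.map (rowIdx c)).sum = rowIdx c n := by omega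
    rw [heq] at hs
    unfold place at hdec
    simp only [mul_add] at *
    omega
  · rw [← closedForm_mod_two, ← h, ← List.sum_map_add, ← Nat.div_one (nimSum _)]
    refine (nimSum_map_div_two_pow_mod_two (k := 0) (fun x => ?_) l).symm
    rw [pow_zero, Nat.div_one]
    exact closedForm_mod_two c x
  · rw [← closedForm_div_two_mod_two, ← h]
    exact (nimSum_map_div_two_pow_mod_two (closedForm_div_two_mod_two c) l).symm
  · rw [← closedForm_div_four_mod_two, ← h]
    exact (nimSum_map_div_two_pow_mod_two (closedForm_div_four_mod_two c) l).symm

lemma two_mul_flipBit_le (K : ℕ) : 2 * flipBit K ≤ K := by unfold flipBit; split <;> omega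

lemma four_mul_highBit_le (K s : ℕ) : 4 * highBit K s ≤ K + 2 * flipBit K := by
  unfold flipBit highBit
  split <;> split <;> omega

lemma two_mul_sum_flipBit_le {α : Type*} (K : α → ℕ) (l : List α) :
    2 * (l.map fun x => flipBit (K x)).sum ≤ (l.map K).sum := by
  induction l with
  | nil => simp
  | cons a l ih =>
    have := two_mul_flipBit_le (K a)
    simp only [List.map_cons, List.sum_cons]
    omega

lemma four_mul_sum_highBit_le {α : Type*} (K s : α → ℕ) (l : List α) :
    4 * (l.map fun x => highBit (K x) (s x)).sum
      ≤ (l.map K).sum + 2 * (l.map fun x => flipBit (K x)).sum := by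
  induction l with
  | nil => simp
  | cons a l ih =>
    have := four_mul_highBit_le (K a) (s a)
    simp only [List.map_cons, List.sum_cons]
    omega

lemma nimSum_ne_of_length_eq_two_mul_add_one {c n : ℕ} (hc : 2 ≤ c) (hn : 0 < n) {l : List ℕ}
    (hl : ∀ x ∈ l, 0 < x) (hlen : l.length = 2 * c + 1) (hsum : l.sum = n) :
    nimSum (l.map (closedForm c)) ≠ closedForm c n := by
  intro h
  obtain ⟨h1, h2, h3, h4⟩ := block_sums_of_nimSum_eq hc hn hl (by omega) hsum h
  have h5 := two_mul_sum_flipBit_le (blockIdx c) l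
  have h6 := four_mul_sum_highBit_le (blockIdx c) (offset c) l
  have hK := blockIdx_lt c n
  have ho := offset_lt hc n
  have hlt : (l.map (blockIdx c)).sum < blockIdx c n := by
    by_contra! hle
    have := Nat.mul_le_mul_left (2 * c) hle
    omega
  have e : ∀ a, 2 * c * a = 2 * (c * a) := fun a => mul_assoc _ _ _
  rw [e, e, hlen] at h1
  generalize (l.map (blockIdx c)).sum = A at *
  generalize (l.map (offset c)).sum = B at *
  generalize (l.map fun x => flipBit (blockIdx c x)).sum = E at *
  generalize (l.map fun x => highBit (blockIdx c x) (offset c x)).sum = H at *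
  generalize blockIdx c n = K at *
  generalize offset c n = s at *
  generalize c * A = X at *
  generalize c * K = Y at *
  unfold flipBit at h2
  unfold highBit at h4
  interval_cases K <;> simp at h2 h4 <;> omega

lemma nimSum_pair_ne {c n a b : ℕ} (hc : 2 ≤ c) (ha : 0 < a) (hb : 0 < b) (hsum : a + b = n) :
    nimSum ([a, b].map (closedForm c)) ≠ closedForm c n := by
  intro h
  obtain ⟨h1, h2, h3, h4⟩ := block_sums_of_nimSum_eq hc (by omega) (l := [a, b])
    (by simp [ha, hb]) (by simp) (by simpa using hsum) h
  simp only [List.map_cons, List.map_nil, List.sum_cons, List.sum_nil, add_zero,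
    List.length_cons, List.length_nil] at h1 h2 h3 h4
  have hK := blockIdx_lt c n
  have ho := offset_lt hc n
  have hoa := offset_lt hc a
  have hob := offset_lt hc b
  generalize blockIdx c a = A at *
  generalize blockIdx c b = B at *
  generalize blockIdx c n = K at *
  generalize offset c a = s at *
  generalize offset c b = t at *
  generalize offset c n = u at *
  have hKAB : K = A + B := by
    have h5 : 2 * c * (A + B) < 2 * c * (K + 1) := by rw [mul_add _ K, mul_one]; omega
    have h6 : 2 * c * K < 2 * c * (A + B + 2) := by rw [mul_add _ (A + B)]; omega
    have h5' := lt_of_mul_lt_mul_left h5 (Nat.zero_le _)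
    have h6' := lt_of_mul_lt_mul_left h6 (Nat.zero_le _)
    omega
  subst hKAB
  have hA : A < 6 := by omega
  have hB : B < 6 := by omega
  have h7 : s + t + 1 = u := by omega
  clear h1 h3 ho hoa hob
  unfold flipBit at h2
  unfold highBit at h4
  interval_cases A <;> interval_cases B <;> simp at hK h2 h4 <;>
    (try split at h4) <;> omega

lemma mex_eq {S : Set ℕ} {m : ℕ} (h : m ∉ S) (h' : ∀ v < m, v ∈ S) : mex S = m := by
  refine le_antisymm (Nat.sInf_le h) (le_csInf ⟨m, h⟩ fun v hv => ?_)
  by_contra! hlt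
  exact hv (h' v hlt)

lemma mex_optionValues {c n : ℕ} (hc : 2 ≤ c) (hn : 0 < n) :
    mex (optionValues c (closedForm c) n) = closedForm c n := by
  apply mex_eq
  · rintro ⟨d, hd, l, hlen, hl, hsum, h⟩
    simp only [Finset.mem_insert, Finset.mem_singleton] at hd
    rcases hd with rfl | rfl
    · obtain ⟨a, b, rfl⟩ := List.length_eq_two.mp hlen
      exact nimSum_pair_ne hc (hl a (by simp)) (hl b (by simp)) (by simpa using hsum) h
    · exact nimSum_ne_of_length_eq_two_mul_add_one hc hn hl hlen hsum h
  · intro v hv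
    have hlt := blockVal_lt (blockIdx c n) (offset c n)
    unfold closedForm at hv
    rw [place_decomp (c := c) hn, ← Nat.div_add_mod v 8]
    rcases Nat.lt_or_ge (v / 8) (rowIdx c n) with h | h
    · exact mem_optionValues_of_row_lt hc (Nat.mod_lt _ (by norm_num)) h
    · rw [show v / 8 = rowIdx c n by omega]
      exact mem_optionValues_of_lt_blockVal hc (blockIdx_lt c n) (offset_lt hc n) (by omega)

lemma lt_sum_of_mem_of_pos {l : List ℕ} (hl : ∀ x ∈ l, 0 < x) (hlen : 2 ≤ l.length) {x : ℕ}
    (hx : x ∈ l) : x < l.sum := by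
  obtain ⟨l₁, l₂, rfl⟩ := List.append_of_mem hx
  have h1 : l₁.length ≤ l₁.sum := List.length_le_sum_of_one_le _ fun y hy => hl y (by simp [hy])
  have h2 : l₂.length ≤ l₂.sum := List.length_le_sum_of_one_le _ fun y hy => hl y (by simp [hy])
  simp only [List.length_append, List.length_cons, List.sum_append, List.sum_cons] at *
  omega

lemma cutGAux_eq_closedForm {c : ℕ} (hc : 2 ≤ c) (fuel n : ℕ) (hn : 0 < n) (hle : n ≤ fuel) :
    cutGAux {1, 2 * c} fuel n = closedForm c n := by
  induction fuel generalizing n with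
  | zero => omega
  | succ fuel ih =>
    rw [← mex_optionValues hc hn, cutGAux]
    congr 1
    ext v
    refine exists_congr fun d => and_congr_right fun hd => exists_congr fun l =>
      and_congr_right fun hlen => and_congr_right fun hl => and_congr_right fun hsum => ?_
    have hd' : 1 ≤ d := by
      simp only [Finset.mem_insert, Finset.mem_singleton] at hd
      omega
    have hmap : l.map (cutGAux {1, 2 * c} fuel) = l.map (closedForm c) :=
      List.map_congr_left fun x hx => by
        have := lt_sum_of_mem_of_pos hl (by omega) hx
        exact ih x (hl x hx) (by omega)
    rw [hmap]
    rfl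

/-- The Grundy values of consecutive numbers differ in the last bit only, except when passing
from an outnumber to an innumber. -/
lemma closedForm_succ {c n : ℕ} (hn : 0 < n) (h1 : offset c n + 1 < 2 * c)
    (h2 : ¬ (blockIdx c n = 2 ∧ offset c n = 0)) :
    closedForm c (n + 1) = closedForm c n ^^^ 1 := by
  have hK := blockIdx_lt c n
  have hsucc : n + 1 = place c (rowIdx c n) (blockIdx c n) (offset c n + 1) := by
    conv_lhs => rw [place_decomp (c := c) hn]
    unfold place
    ring
  rw [hsucc, closedForm_place hK h1, closedForm, eight_mul_add_xor _ _ _ (blockVal_lt _ _)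
    (by norm_num)]
  generalize blockIdx c n = K at *
  generalize offset c n = s at *
  congr 1
  have e1 : blockVal K s = blockVal K (if s % 2 = 0 then 2 else 1) :=
    blockVal_eq_of_mod (by split <;> omega) (by split <;> omega)
  have e2 : blockVal K (s + 1) = blockVal K (if s % 2 = 0 then 1 else 2) :=
    blockVal_eq_of_mod (by split <;> omega) (by split <;> omega)
  rw [e1, e2]
  split <;> interval_cases K <;> rfl

lemma place_mod (c q K s : ℕ) (hK : K < 6) (hs : s + 1 < 2 * c) :
    place c q K s % (12 * c) = 2 * c * K + s + 1 := by
  have h : 2 * c * (K + 1) ≤ 2 * c * 6 := by gcongr; omega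
  have e : place c q K s = 12 * c * q + (2 * c * K + s + 1) := by unfold place; ring
  rw [mul_add] at h
  rw [e, Nat.mul_add_mod, Nat.mod_eq_of_lt (by omega)]

lemma cutG_succ_of_not_outnumber {c n : ℕ} (hc : 2 ≤ c) (hn : 0 < n) (h : ¬ Outnumber c n) :
    cutG {1, 2 * c} (n + 1) = cutG {1, 2 * c} n ^^^ 1 := by
  rw [cutG, cutG, cutGAux_eq_closedForm hc _ _ (by omega) le_rfl,
    cutGAux_eq_closedForm hc _ _ hn le_rfl]
  have ho := offset_lt hc n
  have hlt : offset c n + 1 < 2 * c := by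
    by_contra! hge
    refine h ⟨hn, Or.inl ?_⟩
    have e : n = 2 * c * (6 * rowIdx c n + blockIdx c n + 1) := by
      conv_lhs => rw [place_decomp (c := c) hn]
      unfold place
      rw [mul_add _ _ 1]
      omega
    rw [e, Nat.mul_mod_right]
  refine closedForm_succ hn hlt ?_
  rintro ⟨hK, hs⟩
  refine h ⟨hn, Or.inr ?_⟩
  rw [place_decomp (c := c) hn, place_mod _ _ _ _ (blockIdx_lt c n) hlt, hK, hs]
  ring

lemma cutG_succ_of_not_innumber {c n : ℕ} (hc : 2 ≤ c) (hn : 0 < n) (h : ¬ Innumber c (n + 1)) :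
    cutG {1, 2 * c} (n + 1) = cutG {1, 2 * c} n ^^^ 1 := by
  refine cutG_succ_of_not_outnumber hc hn fun ⟨_, hout⟩ => h ⟨by omega, ?_⟩
  rcases hout with hout | hout
  · left
    rw [Nat.add_mod, hout, Nat.mod_eq_of_lt (by omega : 1 < 2 * c), zero_add,
      Nat.mod_eq_of_lt (by omega)]
  · right
    rw [Nat.add_mod, hout, Nat.mod_eq_of_lt (by omega : 1 < 12 * c), Nat.mod_eq_of_lt (by omega)]

/-- If a partition of `n+1` is not entering, some partition of `n` with the same
number of parts has nim-value differing by `⊕ 1`; and dually for non-exiting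
partitions of `n`. -/
theorem cut_step_partition (c : ℕ) (hc : 2 ≤ c) (p : ℕ) (hp : 2 ≤ p) (n : ℕ) :
    (∀ l : List ℕ, l.length = p → (∀ x ∈ l, 0 < x) → l.sum = n + 1 →
      ¬ Entering c l →
      ∃ l' : List ℕ, l'.length = p ∧ (∀ x ∈ l', 0 < x) ∧ l'.sum = n ∧
        nimVal {1, 2*c} l = nimVal {1, 2*c} l' ^^^ 1) ∧
    (∀ l : List ℕ, l.length = p → (∀ x ∈ l, 0 < x) → l.sum = n →
      ¬ Exiting c l →
      ∃ l' : List ℕ, l'.length = p ∧ (∀ x ∈ l', 0 < x) ∧ l'.sum = n + 1 ∧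
        nimVal {1, 2*c} l' = nimVal {1, 2*c} l ^^^ 1) := by
  constructor
  · intro l hlen hl hsum hne
    simp only [Entering, not_forall] at hne
    obtain ⟨m, hm, hin⟩ := hne
    have hm0 := hl m hm
    obtain ⟨l₁, l₂, rfl⟩ := List.append_of_mem hm
    obtain ⟨k, rfl⟩ : ∃ k, m = k + 1 := ⟨m - 1, by omega⟩
    have hk : 0 < k := by
      by_contra hk
      refine hin ⟨by omega, Or.inl ?_⟩
      rw [show k + 1 = 1 by omega, Nat.mod_eq_of_lt (by omega)]
    refine ⟨l₁ ++ k :: l₂, by simpa using hlen, ?_, ?_, ?_⟩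
    · simp only [List.mem_append, List.mem_cons] at hl ⊢
      rintro x (hx | rfl | hx)
      exacts [hl x (Or.inl hx), hk, hl x (Or.inr (Or.inr hx))]
    · simp only [List.sum_append, List.sum_cons] at hsum ⊢
      omega
    · exact nimSum_map_xor_mid _ _ _ _ _ (cutG_succ_of_not_innumber hc hk hin)
  · intro l hlen hl hsum hne
    simp only [Exiting, not_forall] at hne
    obtain ⟨m, hm, hout⟩ := hne
    have hm0 := hl m hm
    obtain ⟨l₁, l₂, rfl⟩ := List.append_of_mem hm
    refine ⟨l₁ ++ (m + 1) :: l₂, by simpa using hlen, ?_, ?_, ?_⟩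
    · simp only [List.mem_append, List.mem_cons] at hl ⊢
      rintro x (hx | rfl | hx)
      exacts [hl x (Or.inl hx), Nat.succ_pos m, hl x (Or.inr (Or.inr hx))]
    · simp only [List.sum_append, List.sum_cons] at hsum ⊢
      omega
    · exact nimSum_map_xor_mid _ _ _ _ _ (cutG_succ_of_not_outnumber hc hm0 hout)
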